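/- arXiv:2504.21824 — 5 statements merged into one kernel-verified Lean document; each statement's English description precedes it below -/
import Mathlib

section
/- Let 0<s<u<1 and set a=(1+u)^2, b=(1+s)^2, c=(1-s)^2, d=(1-u)^2, and P(t)=(a-t)(t-b)(t-c)(t-d) (so P(t)≥0 on [d,c] and on [b,a]). Then for every real β>-1, ∫_b^a P(t)^β · t^{-β-1/2} dt = ∫_d^c P(t)^β · t^{-β-1/2} dt. -/
open MeasureTheory Set

/-- The odd Laurent polynomial `h` such that
`P (x ^ 2) = x ^ 2 * (4 * (u ^ 2 - s ^ 2) ^ 2 - h x ^ 2)`,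
where `P` is the quartic with roots `(1 ± u) ^ 2` and `(1 ± s) ^ 2`. -/
noncomputable def quarticPhase (s u x : ℝ) : ℝ :=
  x ^ 3 - (2 + s ^ 2 + u ^ 2) * x + (1 - u ^ 2) * (1 - s ^ 2) / x

lemma measurable_quarticPhase (s u : ℝ) : Measurable (quarticPhase s u) := by
  unfold quarticPhase
  fun_prop

lemma continuousOn_quarticPhase (s u : ℝ) : ContinuousOn (quarticPhase s u) (Ioi 0) := by
  unfold quarticPhase
  exact (by fun_prop : Continuous fun x : ℝ => x ^ 3 - (2 + s ^ 2 + u ^ 2) * x).continuousOn.add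
    (continuousOn_const.div continuousOn_id fun x hx => (mem_Ioi.1 hx).ne')

lemma quartic_sq_eq {s u x : ℝ} (hx : x ≠ 0) :
    ((1 + u) ^ 2 - x ^ 2) * (x ^ 2 - (1 + s) ^ 2) * (x ^ 2 - (1 - s) ^ 2) *
      (x ^ 2 - (1 - u) ^ 2) = (4 * (u ^ 2 - s ^ 2) ^ 2 - quarticPhase s u x ^ 2) * x ^ 2 := by
  unfold quarticPhase
  field_simp
  ring

lemma quarticPhase_sub {s u x y : ℝ} (hx : x ≠ 0) (hy : y ≠ 0) :
    quarticPhase s u x - quarticPhase s u y = (x - y) * (x ^ 2 + x * y + y ^ 2 -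
      (2 + s ^ 2 + u ^ 2) - (1 - u ^ 2) * (1 - s ^ 2) / (x * y)) := by
  unfold quarticPhase
  field_simp
  ring

lemma strictMonoOn_quarticPhase {s u : ℝ} (hs : 0 < s) (hsu : s < u) (hu : u < 1) :
    StrictMonoOn (quarticPhase s u) (Icc (1 + s) (1 + u)) := by
  intro y hy x hx hyx
  have hx1 := hx.1
  have hy1 := hy.1
  have hxy : (1 + s) ^ 2 ≤ x * y := by nlinarith
  have hdiv : (1 - u ^ 2) * (1 - s ^ 2) / (x * y) ≤ 1 - u ^ 2 := by
    rw [div_le_iff₀ (by nlinarith)]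
    exact mul_le_mul_of_nonneg_left (by nlinarith) (by nlinarith)
  have hsub := quarticPhase_sub (s := s) (u := u) (x := x) (y := y) (by linarith) (by linarith)
  have : 0 < quarticPhase s u x - quarticPhase s u y := by
    rw [hsub]
    apply mul_pos (by linarith)
    have hx3 : (1 + s) ^ 2 ≤ x ^ 2 := by nlinarith
    have hy3 : (1 + s) ^ 2 ≤ y ^ 2 := by nlinarith
    nlinarith
  linarith

lemma strictAntiOn_quarticPhase {s u : ℝ} (hs : 0 < s) (hsu : s < u) (hu : u < 1) :
    StrictAntiOn (quarticPhase s u) (Icc (1 - u) (1 - s)) := by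
  intro y hy x hx hyx
  have hx1 := hx.1
  have hy1 := hy.1
  have hx2 := hx.2
  have hy2 := hy.2
  have hxy : x * y ≤ (1 - s) ^ 2 := by nlinarith
  have hpos : 0 < x * y := mul_pos (by linarith) (by linarith)
  have hdiv : 1 - u ^ 2 ≤ (1 - u ^ 2) * (1 - s ^ 2) / (x * y) := by
    rw [le_div_iff₀ hpos]
    exact mul_le_mul_of_nonneg_left (by nlinarith) (by nlinarith)
  have hsub := quarticPhase_sub (s := s) (u := u) (x := x) (y := y) (by linarith) (by linarith)
  have : quarticPhase s u x - quarticPhase s u y < 0 := by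
    rw [hsub]
    apply mul_neg_of_pos_of_neg (by linarith)
    nlinarith
  linarith

/-- Vieta's formula for the sum of the roots of `x * (quarticPhase s u x - y)`. -/
lemma sub_eq_sub_of_quarticPhase_eq {s u y p p' q q' : ℝ} (hq : 0 < q) (hq' : 0 < q')
    (hqp : q < p) (hqp' : q' < p') (hpy : quarticPhase s u p = y) (hqy : quarticPhase s u q = y)
    (hpy' : quarticPhase s u p' = -y) (hqy' : quarticPhase s u q' = -y) :
    p - p' = q' - q := by
  have root : ∀ {x z : ℝ}, x ≠ 0 → quarticPhase s u x = z →
      x ^ 4 - (2 + s ^ 2 + u ^ 2) * x ^ 2 - z * x + (1 - u ^ 2) * (1 - s ^ 2) = 0 := by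
    intro x z hx h
    rw [← h]
    unfold quarticPhase
    field_simp
    ring
  have rp := root (by linarith) hpy
  have rq := root hq.ne' hqy
  have rp' := root (by linarith) hpy'
  have rq' := root hq'.ne' hqy'
  have e1 : p ^ 3 + p ^ 2 * q + p * q ^ 2 + q ^ 3 - (2 + s ^ 2 + u ^ 2) * (p + q) - y = 0 := by
    apply mul_left_cancel₀ (sub_ne_zero.2 hqp.ne')
    linear_combination rp - rq
  have e2 : q ^ 3 - q ^ 2 * p' + q * p' ^ 2 - p' ^ 3 - (2 + s ^ 2 + u ^ 2) * (q - p') - y = 0 := by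
    apply mul_left_cancel₀ (by linarith : q + p' ≠ 0)
    linear_combination rq - rp'
  have e3 : -p' ^ 3 - p' ^ 2 * q' - p' * q' ^ 2 - q' ^ 3 + (2 + s ^ 2 + u ^ 2) * (p' + q') - y
      = 0 := by
    apply mul_left_cancel₀ (sub_ne_zero.2 hqp'.ne)
    linear_combination rp' - rq'
  have e4 : p ^ 2 + q ^ 2 + p' ^ 2 + p * q - p * p' - q * p' - (2 + s ^ 2 + u ^ 2) = 0 := by
    apply mul_left_cancel₀ (by linarith : p + p' ≠ 0)
    linear_combination e1 - e2
  have e5 : q ^ 2 + p' ^ 2 + q' ^ 2 - q * p' - q * q' + p' * q' - (2 + s ^ 2 + u ^ 2) = 0 := by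
    apply mul_left_cancel₀ (by linarith : q + q' ≠ 0)
    linear_combination e2 - e3
  have e6 : p + q - p' - q' = 0 := by
    apply mul_left_cancel₀ (by linarith : p + q' ≠ 0)
    linear_combination e4 - e5
  linarith

lemma exists_sq_sublevel_eq_Icc {h : ℝ → ℝ} {l r K y : ℝ} (hlr : l ≤ r)
    (hc : ContinuousOn h (Icc l r)) (hm : StrictMonoOn h (Icc l r)) (hl : h l = -K) (hr : h r = K)
    (hy0 : 0 ≤ y) (hyK : y ≤ K) :
    ∃ x₁ ∈ Icc l r, ∃ x₂ ∈ Icc l r, h x₁ = -y ∧ h x₂ = y ∧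
      (fun x => h x ^ 2) ⁻¹' Iic (y ^ 2) ∩ Icc l r = Icc x₁ x₂ := by
  have hivt := intermediate_value_Icc hlr hc
  rw [hl, hr] at hivt
  obtain ⟨x₁, hx₁, h₁⟩ := hivt (show -y ∈ Icc (-K) K by constructor <;> linarith)
  obtain ⟨x₂, hx₂, h₂⟩ := hivt (show y ∈ Icc (-K) K by constructor <;> linarith)
  refine ⟨x₁, hx₁, x₂, hx₂, h₁, h₂, ?_⟩
  ext x
  simp only [mem_inter_iff, mem_preimage, mem_Iic]
  constructor
  · rintro ⟨hx, hxI⟩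
    have := abs_le.1 (abs_le_of_sq_le_sq hx hy0)
    exact ⟨(hm.le_iff_le hx₁ hxI).1 (by linarith), (hm.le_iff_le hxI hx₂).1 (by linarith)⟩
  · intro hx
    have hxI : x ∈ Icc l r := ⟨hx₁.1.trans hx.1, hx.2.trans hx₂.2⟩
    refine ⟨sq_le_sq' ?_ ?_, hxI⟩
    · rw [← h₁]
      exact (hm.le_iff_le hx₁ hxI).2 hx.1
    · rw [← h₂]
      exact (hm.le_iff_le hxI hx₂).2 hx.2

/-- The square of `quarticPhase s u` has the same distribution on the two intervals. -/
lemma map_sq_quarticPhase_eq {s u : ℝ} (hs : 0 < s) (hsu : s < u) (hu : u < 1) :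
    (volume.restrict (Icc (1 + s) (1 + u))).map (fun x => quarticPhase s u x ^ 2) =
      (volume.restrict (Icc (1 - u) (1 - s))).map (fun x => quarticPhase s u x ^ 2) := by
  have hmeas : Measurable fun x => quarticPhase s u x ^ 2 :=
    (measurable_quarticPhase s u).pow_const 2
  have hmono := strictMonoOn_quarticPhase hs hsu hu
  have hanti := strictAntiOn_quarticPhase hs hsu hu
  have hcont₁ : ContinuousOn (quarticPhase s u) (Icc (1 + s) (1 + u)) :=
    (continuousOn_quarticPhase s u).mono fun x hx => mem_Ioi.2 (by linarith [hx.1])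
  have hcont₂ : ContinuousOn (quarticPhase s u) (Icc (1 - u) (1 - s)) :=
    (continuousOn_quarticPhase s u).mono fun x hx => mem_Ioi.2 (by linarith [hx.1])
  have hv₁ : quarticPhase s u (1 + s) = -(2 * (u ^ 2 - s ^ 2)) := by
    have : 1 + s ≠ 0 := by linarith
    unfold quarticPhase
    field_simp
    ring
  have hv₂ : quarticPhase s u (1 + u) = 2 * (u ^ 2 - s ^ 2) := by
    have : 1 + u ≠ 0 := by linarith
    unfold quarticPhase
    field_simp
    ring
  have hv₃ : -quarticPhase s u (1 - u) = -(2 * (u ^ 2 - s ^ 2)) := by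
    have : 1 - u ≠ 0 := by linarith
    unfold quarticPhase
    field_simp
    ring
  have hv₄ : -quarticPhase s u (1 - s) = 2 * (u ^ 2 - s ^ 2) := by
    have : 1 - s ≠ 0 := by linarith
    unfold quarticPhase
    field_simp
    ring
  have key : ∀ y, 0 ≤ y → y ≤ 2 * (u ^ 2 - s ^ 2) →
      volume ((fun x => quarticPhase s u x ^ 2) ⁻¹' Iic (y ^ 2) ∩ Icc (1 + s) (1 + u)) =
      volume ((fun x => quarticPhase s u x ^ 2) ⁻¹' Iic (y ^ 2) ∩ Icc (1 - u) (1 - s)) := by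
    intro y hy hyK
    obtain ⟨p', hp', p, hp, hpy', hpy, hset⟩ :=
      exists_sq_sublevel_eq_Icc (by linarith) hcont₁ hmono hv₁ hv₂ hy hyK
    obtain ⟨q, hq, q', hq', hqy, hqy', hset'⟩ :=
      exists_sq_sublevel_eq_Icc (h := fun x => -quarticPhase s u x) (by linarith) hcont₂.neg
        (fun x hx z hz hxz => neg_lt_neg (hanti hx hz hxz)) hv₃ hv₄ hy hyK
    simp only [neg_sq] at hset'
    rw [hset, hset', Real.volume_Icc, Real.volume_Icc,
      sub_eq_sub_of_quarticPhase_eq (s := s) (u := u) (y := y) (p := p) (p' := p') (q := q)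
        (q' := q') (by linarith [hq.1]) (by linarith [hq'.1]) (by linarith [hq.2, hp.1])
        (by linarith [hq'.2, hp'.1]) hpy (by linarith) hpy' (by linarith)]
  refine Measure.ext_of_Iic _ _ fun t => ?_
  rw [Measure.map_apply hmeas measurableSet_Iic, Measure.map_apply hmeas measurableSet_Iic,
    Measure.restrict_apply (hmeas measurableSet_Iic),
    Measure.restrict_apply (hmeas measurableSet_Iic)]
  rcases lt_or_ge t 0 with ht | ht
  · have : (fun x => quarticPhase s u x ^ 2) ⁻¹' Iic t = ∅ :=
      eq_empty_of_forall_notMem fun x hx => (ht.trans_le (sq_nonneg _)).not_ge hx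
    simp [this]
  have hK : 0 ≤ 2 * (u ^ 2 - s ^ 2) := by nlinarith
  rcases le_total (√t) (2 * (u ^ 2 - s ^ 2)) with htK | htK
  · simpa only [Real.sq_sqrt ht] using key (√t) (Real.sqrt_nonneg t) htK
  · have hle : (2 * (u ^ 2 - s ^ 2)) ^ 2 ≤ t := by
      rw [← Real.sq_sqrt ht]
      exact pow_le_pow_left₀ hK htK 2
    have h₁ : (fun x => quarticPhase s u x ^ 2) ⁻¹' Iic t ∩ Icc (1 + s) (1 + u) =
        Icc (1 + s) (1 + u) := by
      refine inter_eq_right.2 fun x hx => (sq_le_sq' ?_ ?_).trans hle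
      · rw [← hv₁]
        exact hmono.monotoneOn (left_mem_Icc.2 (by linarith)) hx hx.1
      · rw [← hv₂]
        exact hmono.monotoneOn hx (right_mem_Icc.2 (by linarith)) hx.2
    have h₂ : (fun x => quarticPhase s u x ^ 2) ⁻¹' Iic t ∩ Icc (1 - u) (1 - s) =
        Icc (1 - u) (1 - s) := by
      refine inter_eq_right.2 fun x hx => (sq_le_sq' ?_ ?_).trans hle
      · rw [← hv₄, neg_neg]
        exact hanti.antitoneOn hx (right_mem_Icc.2 (by linarith)) hx.2
      · rw [← neg_injective hv₃]
        exact hanti.antitoneOn (left_mem_Icc.2 (by linarith)) hx hx.1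
    rw [h₁, h₂, Real.volume_Icc, Real.volume_Icc]
    congr 1
    ring

lemma image_sq_Icc {l r : ℝ} (hl : 0 ≤ l) (hlr : l ≤ r) :
    (fun x : ℝ => x ^ 2) '' Icc l r = Icc (l ^ 2) (r ^ 2) := by
  refine Subset.antisymm ?_ (intermediate_value_Icc hlr (continuous_pow 2).continuousOn)
  rintro _ ⟨x, hx, rfl⟩
  exact ⟨pow_le_pow_left₀ hl hx.1 2, pow_le_pow_left₀ (hl.trans hx.1) hx.2 2⟩

lemma intervalIntegral_quartic_eq {s u β l r : ℝ} (hl : 0 < l) (hlr : l ≤ r) {P : ℝ → ℝ}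
    (hP : ∀ t, P t = ((1 + u) ^ 2 - t) * (t - (1 + s) ^ 2) * (t - (1 - s) ^ 2) *
      (t - (1 - u) ^ 2))
    (hnonneg : ∀ x ∈ Icc l r, 0 ≤ P (x ^ 2)) :
    ∫ t in (l ^ 2)..(r ^ 2), P t ^ β * t ^ (-β - 1 / 2) =
      ∫ x in Icc l r, 2 * (4 * (u ^ 2 - s ^ 2) ^ 2 - quarticPhase s u x ^ 2) ^ β := by
  rw [intervalIntegral.integral_of_le (pow_le_pow_left₀ hl.le hlr 2),
    ← integral_Icc_eq_integral_Ioc, ← image_sq_Icc hl.le hlr,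
    integral_image_eq_integral_abs_deriv_smul (f' := fun x => 2 * x) measurableSet_Icc
      (fun x _ => by simpa using (hasDerivAt_pow 2 x).hasDerivWithinAt)
      (fun x hx y hy hxy =>
        (pow_left_inj₀ (hl.le.trans hx.1) (hl.le.trans hy.1) two_ne_zero).1 hxy)]
  refine setIntegral_congr_fun measurableSet_Icc fun x hx => ?_
  have hx0 : 0 < x := hl.trans_le hx.1
  have hfac : P (x ^ 2) = (4 * (u ^ 2 - s ^ 2) ^ 2 - quarticPhase s u x ^ 2) * x ^ 2 := by
    rw [hP, quartic_sq_eq hx0.ne']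
  have hw : 0 ≤ 4 * (u ^ 2 - s ^ 2) ^ 2 - quarticPhase s u x ^ 2 :=
    nonneg_of_mul_nonneg_left (hfac ▸ hnonneg x hx) (by positivity)
  have hpow : x * ((x ^ 2) ^ β * (x ^ 2) ^ (-β - 1 / 2)) = 1 := by
    rw [← Real.rpow_add (by positivity), show β + (-β - 1 / 2) = -(1 / 2 : ℝ) by ring,
      Real.rpow_neg (by positivity), ← Real.sqrt_eq_rpow, Real.sqrt_sq hx0.le,
      mul_inv_cancel₀ hx0.ne']
  simp only [smul_eq_mul]
  rw [abs_of_pos (by linarith), hfac, Real.mul_rpow hw (by positivity)]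
  linear_combination (2 * (4 * (u ^ 2 - s ^ 2) ^ 2 - quarticPhase s u x ^ 2) ^ β) * hpow


/-- **Elliptic integral identity** (Theorem `Elliptic_Integrals`).
For `0 < s < u < 1`, with `a = (1+u)^2`, `b = (1+s)^2`, `c = (1-s)^2`, `d = (1-u)^2`
and `P t = (a-t)(t-b)(t-c)(t-d)`, for every real `β > -1`,
`∫_b^a P(t)^β t^{-β-1/2} dt = ∫_d^c P(t)^β t^{-β-1/2} dt`. -/
theorem elliptic_integral_identity
    (s u : ℝ) (hs : 0 < s) (hsu : s < u) (hu : u < 1)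
    (a b c d : ℝ)
    (ha : a = (1 + u) ^ 2) (hb : b = (1 + s) ^ 2)
    (hc : c = (1 - s) ^ 2) (hd : d = (1 - u) ^ 2)
    (P : ℝ → ℝ) (hP : ∀ t, P t = (a - t) * (t - b) * (t - c) * (t - d))
    (β : ℝ) (hβ : -1 < β) :
    (∫ t in b..a, P t ^ β * t ^ (-β - 1 / 2)) =
      ∫ t in d..c, P t ^ β * t ^ (-β - 1 / 2) := by
  subst ha hb hc hd
  have hsq : ∀ {x y : ℝ}, 0 ≤ x → x ≤ y → 0 ≤ y ^ 2 - x ^ 2 := fun hx hxy =>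
    sub_nonneg.2 (pow_le_pow_left₀ hx hxy 2)
  have hnonneg₁ : ∀ x ∈ Icc (1 + s) (1 + u), 0 ≤ P (x ^ 2) := by
    intro x hx
    have h1 := hx.1
    rw [hP]
    exact mul_nonneg (mul_nonneg (mul_nonneg (hsq (by linarith) hx.2) (hsq (by linarith) h1))
      (hsq (by linarith) (by linarith))) (hsq (by linarith) (by linarith))
  have hnonneg₂ : ∀ x ∈ Icc (1 - u) (1 - s), 0 ≤ P (x ^ 2) := by
    intro x hx
    have h1 := hx.1
    have h2 := hx.2
    have hprod := mul_nonneg (mul_nonneg (mul_nonneg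
      (hsq (x := x) (y := 1 + u) (by linarith) (by linarith))
      (hsq (x := x) (y := 1 + s) (by linarith) (by linarith)))
      (hsq (x := x) (y := 1 - s) (by linarith) (by linarith)))
      (hsq (x := 1 - u) (y := x) (by linarith) h1)
    rw [hP]
    linarith
  rw [intervalIntegral_quartic_eq (by linarith) (by linarith) hP hnonneg₁,
    intervalIntegral_quartic_eq (by linarith) (by linarith) hP hnonneg₂]
  have hmeas : Measurable fun x => quarticPhase s u x ^ 2 :=
    (measurable_quarticPhase s u).pow_const 2
  have hF : Measurable fun y : ℝ => 2 * (4 * (u ^ 2 - s ^ 2) ^ 2 - y) ^ β := by fun_prop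
  have htransfer := congrArg (fun μ => ∫ y, 2 * (4 * (u ^ 2 - s ^ 2) ^ 2 - y) ^ β ∂μ)
    (map_sq_quarticPhase_eq hs hsu hu)
  simpa only [integral_map hmeas.aemeasurable hF.aestronglyMeasurable] using htransfer
end

section
/- Let 0<s<u<1, a=(1+u)^2, b=(1+s)^2, c=(1-s)^2, d=(1-u)^2, P(t)=(a-t)(t-b)(t-c)(t-d). Define v=(s^2+u^2+2)^2+12(1-u^2)(1-s^2), w=8(u^2+s^2)+(u^2-s^2)^2, and r_1=(s^2+u^2+2)/6 - √v/6, r_2=(s^2+u^2+2)/2 - √w/2, r_3=(s^2+u^2+2)/6 + √v/6, r_4=(s^2+u^2+2)/2 + √w/2. Then for all real t, t·P'(t) - P(t) = -3(t-r_1)(t-r_2)(t-r_3)(t-r_4), and moreover r_1 < 0 < d ≤ r_2 ≤ c ≤ r_3 ≤ b ≤ r_4 ≤ a. Consequently the derivative of y(t)=P(t)/t on (0,∞) vanishes exactly at r_2, r_3, r_4. -/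
/-- Lemma on the critical points of `y(t) = P(t)/t` where
`P t = (a-t)(t-b)(t-c)(t-d)`, `a = (1+u)^2`, `b = (1+s)^2`, `c = (1-s)^2`, `d = (1-u)^2`,
`0 < s < u < 1`.  One has `t P'(t) - P(t) = -3 (t-r₁)(t-r₂)(t-r₃)(t-r₄)` with
`r₁ < 0 < d ≤ r₂ ≤ c ≤ r₃ ≤ b ≤ r₄ ≤ a`; consequently on `(0,∞)` the derivative of `y`
vanishes exactly at `r₂, r₃, r₄`. -/
theorem critical_points_of_P_div_t
    (s u : ℝ) (hs : 0 < s) (hsu : s < u) (hu : u < 1)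
    (a b c d : ℝ)
    (ha : a = (1 + u) ^ 2) (hb : b = (1 + s) ^ 2)
    (hc : c = (1 - s) ^ 2) (hd : d = (1 - u) ^ 2)
    (P : ℝ → ℝ) (hP : ∀ t, P t = (a - t) * (t - b) * (t - c) * (t - d))
    (v w : ℝ)
    (hv : v = (s ^ 2 + u ^ 2 + 2) ^ 2 + 12 * (1 - u ^ 2) * (1 - s ^ 2))
    (hw : w = 8 * (u ^ 2 + s ^ 2) + (u ^ 2 - s ^ 2) ^ 2)
    (r₁ r₂ r₃ r₄ : ℝ)
    (hr₁ : r₁ = (s ^ 2 + u ^ 2 + 2) / 6 - Real.sqrt v / 6)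
    (hr₂ : r₂ = (s ^ 2 + u ^ 2 + 2) / 2 - Real.sqrt w / 2)
    (hr₃ : r₃ = (s ^ 2 + u ^ 2 + 2) / 6 + Real.sqrt v / 6)
    (hr₄ : r₄ = (s ^ 2 + u ^ 2 + 2) / 2 + Real.sqrt w / 2) :
    (∀ t : ℝ, t * deriv P t - P t
        = -3 * (t - r₁) * (t - r₂) * (t - r₃) * (t - r₄)) ∧
    (r₁ < 0 ∧ 0 < d ∧ d ≤ r₂ ∧ r₂ ≤ c ∧ c ≤ r₃ ∧ r₃ ≤ b ∧ b ≤ r₄ ∧ r₄ ≤ a) ∧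
    (∀ t : ℝ, 0 < t →
      (deriv (fun x => P x / x) t = 0 ↔ t = r₂ ∨ t = r₃ ∨ t = r₄)) := by
  have hu0 : 0 < u := hs.trans hsu
  have hs1 : s < 1 := hsu.trans hu
  have hus : 0 < u ^ 2 - s ^ 2 := sub_pos.mpr (pow_lt_pow_left₀ hsu hs.le two_ne_zero)
  have hu2 : 0 < 1 - u ^ 2 := sub_pos.mpr (pow_lt_one₀ hu0.le hu two_ne_zero)
  have hs2 : 0 < 1 - s ^ 2 := sub_pos.mpr (pow_lt_one₀ hs.le hs1 two_ne_zero)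
  have hq : 0 < (1 - u ^ 2) * (1 - s ^ 2) := mul_pos hu2 hs2
  have hw0 : 0 ≤ w := by rw [hw]; positivity
  have hv0 : 0 ≤ v := by rw [hv]; positivity
  have hsv : √v ^ 2 = (s ^ 2 + u ^ 2 + 2) ^ 2 + 12 * (1 - u ^ 2) * (1 - s ^ 2) :=
    (Real.sq_sqrt hv0).trans hv
  have hsw : √w ^ 2 = 8 * (u ^ 2 + s ^ 2) + (u ^ 2 - s ^ 2) ^ 2 := (Real.sq_sqrt hw0).trans hw
  have h13 (t : ℝ) : 3 * ((t - r₁) * (t - r₃)) =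
      3 * t ^ 2 - (s ^ 2 + u ^ 2 + 2) * t - (1 - u ^ 2) * (1 - s ^ 2) := by
    rw [hr₁, hr₃]
    linear_combination (-1 / 12) * hsv
  have h24 (t : ℝ) : (t - r₂) * (t - r₄) =
      t ^ 2 - (s ^ 2 + u ^ 2 + 2) * t + (1 - u ^ 2) * (1 - s ^ 2) := by
    rw [hr₂, hr₄]
    linear_combination (-1 / 4) * hsw
  have hder (t : ℝ) : HasDerivAt P
      (((-1 * (t - b) + (a - t) * 1) * (t - c) + (a - t) * (t - b) * 1) * (t - d)
        + (a - t) * (t - b) * (t - c) * 1) t := by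
    rw [funext hP]
    exact ((((hasDerivAt_id t).const_sub a).mul ((hasDerivAt_id t).sub_const b)).mul
      ((hasDerivAt_id t).sub_const c)).mul ((hasDerivAt_id t).sub_const d)
  have hfactor (t : ℝ) : t * deriv P t - P t
      = -3 * (t - r₁) * (t - r₂) * (t - r₃) * (t - r₄) := by
    have key : -3 * (t - r₁) * (t - r₂) * (t - r₃) * (t - r₄) =
        -((3 * ((t - r₁) * (t - r₃))) * ((t - r₂) * (t - r₄))) := by ring
    rw [key, h13, h24, (hder t).deriv, hP, ha, hb, hc, hd]
    ring
  have hr₁_neg : r₁ < 0 := by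
    have : s ^ 2 + u ^ 2 + 2 < √v := Real.lt_sqrt_of_sq_lt (by rw [hv]; linarith)
    rw [hr₁]; linarith
  have hd_pos : 0 < d := by rw [hd]; exact pow_pos (by linarith) 2
  have hd_le : d ≤ r₂ := by
    have : √w ≤ s ^ 2 - u ^ 2 + 4 * u := by
      refine Real.sqrt_le_iff.mpr ⟨by linarith [mul_pos hu0 (sub_pos.mpr hu), sq_nonneg s], ?_⟩
      rw [hw]
      linarith [mul_pos hus (sub_pos.mpr hu)]
    rw [hd, hr₂]; linarith
  have hr₂_le : r₂ ≤ c := by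
    have : u ^ 2 - s ^ 2 + 4 * s ≤ √w := by
      refine Real.le_sqrt_of_sq_le ?_
      rw [hw]
      linarith [mul_pos hus (sub_pos.mpr hs1)]
    rw [hc, hr₂]; linarith
  have hc_le : c ≤ r₃ := by
    have hc0 : 0 < c := by rw [hc]; exact pow_pos (by linarith) 2
    have hQ : 3 * ((c - r₁) * (c - r₃)) ≤ 0 := by
      have : 3 * ((c - r₁) * (c - r₃)) =
          -((1 - s) * (2 * s * (1 - u ^ 2) + (1 - s) * (2 * s * (3 - s)))) := by
        rw [h13, hc]; ring
      rw [this, neg_nonpos]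
      have h1 : 0 < 1 - s := by linarith
      have h3 : 0 < 3 - s := by linarith
      positivity
    exact sub_nonpos.mp (nonpos_of_mul_nonpos_right (by linarith) (sub_pos.mpr (hr₁_neg.trans hc0)))
  have hr₃_le : r₃ ≤ b := by
    have hb0 : 0 < b := by rw [hb]; positivity
    have hQ : 0 ≤ 3 * ((b - r₁) * (b - r₃)) := by
      have : 3 * ((b - r₁) * (b - r₃)) =
          (1 + s) * (2 * s * (1 - u ^ 2) + (1 + s) * (2 * s * (3 + s))) := by
        rw [h13, hb]; ring
      rw [this]
      positivity
    exact sub_nonneg.mp (nonneg_of_mul_nonneg_right (by linarith) (sub_pos.mpr (hr₁_neg.trans hb0)))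
  have hb_le : b ≤ r₄ := by
    have : s ^ 2 - u ^ 2 + 4 * s ≤ √w := by
      refine Real.le_sqrt_of_sq_le ?_
      rw [hw]
      linarith [mul_pos hus hs]
    rw [hb, hr₄]; linarith
  have hr₄_le : r₄ ≤ a := by
    have : √w ≤ u ^ 2 - s ^ 2 + 4 * u := by
      refine Real.sqrt_le_iff.mpr ⟨by linarith, ?_⟩
      rw [hw]
      linarith [mul_pos hus hu0]
    rw [ha, hr₄]; linarith
  refine ⟨hfactor, ⟨hr₁_neg, hd_pos, hd_le, hr₂_le, hc_le, hr₃_le, hb_le, hr₄_le⟩,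
    fun t ht => ?_⟩
  have hquot : deriv (fun x => P x / x) t = (t * deriv P t - P t) / t ^ 2 := by
    have h := ((hder t).differentiableAt.hasDerivAt.div (hasDerivAt_id t) ht.ne').deriv
    refine Eq.trans h ?_
    simp only [id, mul_one, mul_comm t]
  have ht₁ : t - r₁ ≠ 0 := (sub_pos.mpr (hr₁_neg.trans ht)).ne'
  rw [hquot, hfactor, div_eq_zero_iff]
  simp [ht.ne', ht₁, sub_eq_zero, or_assoc]
end

section
/- Let 0<s<u<1, a=(1+u)^2, b=(1+s)^2, c=(1-s)^2, d=(1-u)^2, P(t)=(a-t)(t-b)(t-c)(t-d), and let r_2=(s^2+u^2+2)/2 - √w/2 and r_4=(s^2+u^2+2)/2 + √w/2 where w=8(u^2+s^2)+(u^2-s^2)^2. Then P(r_2)=4(u^2-s^2)^2·r_2 and P(r_4)=4(u^2-s^2)^2·r_4; in particular P(r_2)/r_2 = P(r_4)/r_4, i.e. the function y(t)=P(t)/t attains the same value at r_2 and r_4. -/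
/-- The quartic `P(t) - 4(u²-s²)² t` is minus the square of a quadratic. -/
theorem quartic_sub_linear_eq_neg_sq (s u t : ℝ) :
    ((1 + u) ^ 2 - t) * (t - (1 + s) ^ 2) * (t - (1 - s) ^ 2) * (t - (1 - u) ^ 2)
      - 4 * (u ^ 2 - s ^ 2) ^ 2 * t
      = -(t ^ 2 - (s ^ 2 + u ^ 2 + 2) * t + (1 - s ^ 2) * (1 - u ^ 2)) ^ 2 := by
  ring


/-- The function `y(t) = P(t)/t` attains the same value at the two local maximum points
`r₂` and `r₄`: indeed `P(r₂) = 4(u²-s²)² r₂` and `P(r₄) = 4(u²-s²)² r₄`. -/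
theorem equal_maxima_of_P_div_t
    (s u : ℝ) (hs : 0 < s) (hsu : s < u) (hu : u < 1)
    (a b c d : ℝ)
    (ha : a = (1 + u) ^ 2) (hb : b = (1 + s) ^ 2)
    (hc : c = (1 - s) ^ 2) (hd : d = (1 - u) ^ 2)
    (P : ℝ → ℝ) (hP : ∀ t, P t = (a - t) * (t - b) * (t - c) * (t - d))
    (w : ℝ) (hw : w = 8 * (u ^ 2 + s ^ 2) + (u ^ 2 - s ^ 2) ^ 2)
    (r₂ r₄ : ℝ)
    (hr₂ : r₂ = (s ^ 2 + u ^ 2 + 2) / 2 - Real.sqrt w / 2)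
    (hr₄ : r₄ = (s ^ 2 + u ^ 2 + 2) / 2 + Real.sqrt w / 2) :
    P r₂ = 4 * (u ^ 2 - s ^ 2) ^ 2 * r₂ ∧
    P r₄ = 4 * (u ^ 2 - s ^ 2) ^ 2 * r₄ ∧
    P r₂ / r₂ = P r₄ / r₄ := by
  have hsqrt : Real.sqrt w ^ 2 = w := Real.sq_sqrt (by rw [hw]; positivity)
  have hvalue : ∀ t, t ^ 2 - (s ^ 2 + u ^ 2 + 2) * t + (1 - s ^ 2) * (1 - u ^ 2) = 0 →
      P t = 4 * (u ^ 2 - s ^ 2) ^ 2 * t := by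
    intro t ht
    have h := quartic_sub_linear_eq_neg_sq s u t
    rw [ht] at h
    rw [hP, ha, hb, hc, hd]
    linarith
  have h₂ := hvalue r₂ (by rw [hr₂]; linear_combination hsqrt / 4 + hw / 4)
  have h₄ := hvalue r₄ (by rw [hr₄]; linear_combination hsqrt / 4 + hw / 4)
  have hprod : r₂ * r₄ = (1 - s ^ 2) * (1 - u ^ 2) := by
    rw [hr₂, hr₄]
    linear_combination -hsqrt / 4 - hw / 4
  have hne : r₂ * r₄ ≠ 0 := by
    rw [hprod]
    have h1 : 0 < 1 - s ^ 2 := by nlinarith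
    have h2 : 0 < 1 - u ^ 2 := by nlinarith
    positivity
  refine ⟨h₂, h₄, ?_⟩
  rw [h₂, h₄, mul_div_cancel_right₀ _ (left_ne_zero_of_mul hne),
    mul_div_cancel_right₀ _ (right_ne_zero_of_mul hne)]
end

section
/- Let 0<s<u<1, a=(1+u)^2, b=(1+s)^2, c=(1-s)^2, d=(1-u)^2, P(t)=(a-t)(t-b)(t-c)(t-d), and let γ = 4(u^2-s^2)^2·r_4 / r_4 = 4(u^2-s^2)^2? More precisely let γ denote the common maximal value of y(t)=P(t)/t over [d,c] (equivalently over [b,a]). Fix q ∈ (0,γ) and suppose t_1 ≥ t_2 ≥ t_3 ≥ t_4 are real numbers such that -P(t) + q·t = (t-t_1)(t-t_2)(t-t_3)(t-t_4) for all t. Then t_4 ≥ d > 0 and √t_1 + √t_4 = √t_2 + √t_3. -/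
/-- If the quartic relation `4 e₂ - e₁² = 8 x₁ x₂ x₃ x₄` holds between the squares of
four ordered positive numbers, then the outer pair and the inner pair have the same sum. -/
theorem outer_add_eq_inner_add {x₁ x₂ x₃ x₄ : ℝ} (h12 : x₂ ≤ x₁) (h23 : x₃ ≤ x₂)
    (h34 : x₄ ≤ x₃) (h4 : 0 < x₄)
    (h : 4 * (x₁ ^ 2 * x₂ ^ 2 + x₁ ^ 2 * x₃ ^ 2 + x₁ ^ 2 * x₄ ^ 2 + x₂ ^ 2 * x₃ ^ 2 +
        x₂ ^ 2 * x₄ ^ 2 + x₃ ^ 2 * x₄ ^ 2) - (x₁ ^ 2 + x₂ ^ 2 + x₃ ^ 2 + x₄ ^ 2) ^ 2 =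
      8 * (x₁ * x₂ * x₃ * x₄)) :
    x₁ + x₄ = x₂ + x₃ := by
  have hfac : (x₁ + x₂ + x₃ + x₄) * ((x₁ + x₂ - x₃ - x₄) *
      ((x₁ + x₃ - x₂ - x₄) * (x₁ + x₄ - x₂ - x₃))) = 0 := by
    linear_combination -h
  have hsum : x₁ + x₂ + x₃ + x₄ ≠ 0 := by linarith
  rcases mul_eq_zero.1 ((mul_eq_zero.1 hfac).resolve_left hsum) with h0 | h0
  · linarith
  · rcases mul_eq_zero.1 h0 with h0 | h0 <;> linarith

/-- **Square roots of the roots of the quartic** (Lemma `Quartic poly`).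
Let `γ = 4(u²-s²)²` be the common maximal value of `y(t) = P(t)/t` on `[d,c]` and `[b,a]`.
For `q ∈ (0,γ)`, if `t₁ ≥ t₂ ≥ t₃ ≥ t₄` are the roots of `-P(t) + q t`, then all roots
satisfy `tᵢ ≥ d > 0`, and `√t₁ + √t₄ = √t₂ + √t₃`. -/
theorem sqrt_roots_of_quartic
    (s u : ℝ) (hs : 0 < s) (hsu : s < u) (hu : u < 1)
    (a b c d : ℝ)
    (ha : a = (1 + u) ^ 2) (hb : b = (1 + s) ^ 2)
    (hc : c = (1 - s) ^ 2) (hd : d = (1 - u) ^ 2)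
    (P : ℝ → ℝ) (hP : ∀ t, P t = (a - t) * (t - b) * (t - c) * (t - d))
    (γ : ℝ) (hγ : γ = 4 * (u ^ 2 - s ^ 2) ^ 2)
    (q : ℝ) (hq : q ∈ Set.Ioo 0 γ)
    (t₁ t₂ t₃ t₄ : ℝ) (h12 : t₂ ≤ t₁) (h23 : t₃ ≤ t₂) (h34 : t₄ ≤ t₃)
    (hroots : ∀ t : ℝ, -P t + q * t = (t - t₁) * (t - t₂) * (t - t₃) * (t - t₄)) :
    d ≤ t₄ ∧ 0 < d ∧
      Real.sqrt t₁ + Real.sqrt t₄ = Real.sqrt t₂ + Real.sqrt t₃ := by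
  obtain ⟨hq0, hqγ⟩ := hq
  have hsq : 0 < 1 - s ^ 2 := by nlinarith
  have huq : 0 < 1 - u ^ 2 := by nlinarith
  have hd0 : 0 < d := by rw [hd]; exact pow_pos (by linarith) 2
  have hdc : d < c := by rw [hd, hc]; nlinarith
  have hcb : c < b := by rw [hc, hb]; nlinarith
  have hba : b < a := by rw [hb, ha]; nlinarith
  have hform : ∀ t, (t ^ 2 - (2 + s ^ 2 + u ^ 2) * t + (1 - s ^ 2) * (1 - u ^ 2)) ^ 2 -
      (γ - q) * t = (t - t₁) * (t - t₂) * (t - t₃) * (t - t₄) := by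
    intro t
    rw [← hroots t, hP, ha, hb, hc, hd, hγ]
    ring
  have hd4 : d ≤ t₄ := by
    by_contra! hlt
    have hr := hroots t₄
    rw [hP, sub_self, mul_zero] at hr
    have hpos : 0 < (a - t₄) * (b - t₄) * (c - t₄) * (d - t₄) := by
      have h1 : 0 < a - t₄ := by linarith
      have h2 : 0 < b - t₄ := by linarith
      have h3 : 0 < c - t₄ := by linarith
      have h4 : 0 < d - t₄ := by linarith
      positivity
    have hneg : t₄ < 0 := by
      by_contra! h0
      nlinarith [mul_nonneg hq0.le h0]
    have hf := hform t₄
    rw [sub_self, mul_zero] at hf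
    nlinarith [mul_pos (sub_pos.2 hqγ) (neg_pos.2 hneg),
      sq_nonneg (t₄ ^ 2 - (2 + s ^ 2 + u ^ 2) * t₄ + (1 - s ^ 2) * (1 - u ^ 2))]
  refine ⟨hd4, hd0, ?_⟩
  have p4 : 0 < t₄ := hd0.trans_le hd4
  have p3 : 0 < t₃ := p4.trans_le h34
  have p2 : 0 < t₂ := p3.trans_le h23
  have p1 : 0 < t₁ := p2.trans_le h12
  have f0 := hform 0
  have f1 := hform 1
  have f1' := hform (-1)
  have f2 := hform 2
  have he1 : t₁ + t₂ + t₃ + t₄ = 2 * (2 + s ^ 2 + u ^ 2) := by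
    linear_combination (f2 - f0 - 4 * ((f1 + f1') / 2 - f0) - (f1 - f1')) / 6
  have he2 : t₁ * t₂ + t₁ * t₃ + t₁ * t₄ + t₂ * t₃ + t₂ * t₄ + t₃ * t₄ =
      (2 + s ^ 2 + u ^ 2) ^ 2 + 2 * ((1 - s ^ 2) * (1 - u ^ 2)) := by
    linear_combination f0 - (f1 + f1') / 2
  have he4 : √t₁ * √t₂ * √t₃ * √t₄ = (1 - s ^ 2) * (1 - u ^ 2) := by
    rw [← Real.sqrt_mul p1.le, ← Real.sqrt_mul (by positivity), ← Real.sqrt_mul (by positivity),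
      Real.sqrt_eq_iff_mul_self_eq (by positivity) (by positivity)]
    linear_combination -f0
  apply outer_add_eq_inner_add (Real.sqrt_le_sqrt h12) (Real.sqrt_le_sqrt h23)
    (Real.sqrt_le_sqrt h34) (Real.sqrt_pos.2 p4)
  rw [Real.sq_sqrt p1.le, Real.sq_sqrt p2.le, Real.sq_sqrt p3.le, Real.sq_sqrt p4.le, he4, he1,
    he2]
  ring
end

section
/- Let α ≥ 0 be a real number and let f : [0,1) → ℝ be a smooth function with compact support contained in [0,1). For t ∈ (0,2) define h(t) = ∫_{|1-t|}^{1} u f(u) ([(1+u)^2 - t^2][t^2 - (1-u)^2])^{α-1/2} du. Then for every s ∈ (0,1), ∫_0^{1-s} t^{1-2α} h(t) ([(1+t)^2 - s^2][(1-t)^2 - s^2])^{α-1/2} dt = ∫_{1+s}^{2} t^{1-2α} h(t) ([(1+t)^2 - s^2][(1-t)^2 - s^2])^{α-1/2} dt. -/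
/-- A quartic polynomial in `t ^ 2`; the kernel of the iterated integral over `u` and `t` is
`(kernelPoly s u t / t ^ 2) ^ (α - 1 / 2)`. -/
def kernelPoly (s u t : ℝ) : ℝ :=
  (((1 + u) ^ 2 - t ^ 2) * (t ^ 2 - (1 - u) ^ 2)) * (((1 + t) ^ 2 - s ^ 2) * ((1 - t) ^ 2 - s ^ 2))

lemma kernelPoly_sub_eq_neg_mul {s u C X Y : ℝ}
    (hsum : X + Y = 2 + u ^ 2 + s ^ 2 - 2 * C)
    (hmul : X * Y =
      (1 - u ^ 2) * (1 - s ^ 2) - 3 * C ^ 2 + C * (2 + u ^ 2 + s ^ 2)) (t : ℝ) :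
    kernelPoly s u t -
        2 * ((2 * (2 - u ^ 2 - s ^ 2) ^ 2 -
            (1 - u ^ 2) * (1 - s ^ 2) * (6 - u ^ 2 - s ^ 2)) -
          (2 * C * (4 * C - (2 + u ^ 2 + s ^ 2)) ^ 2 -
            (1 - u ^ 2) * (1 - s ^ 2) * (8 * C - (2 + u ^ 2 + s ^ 2)))) * t ^ 2 =
      -((t ^ 4 - 2 * (C + X) * t ^ 2 + (C - X) ^ 2) *
        (t ^ 4 - 2 * (C + Y) * t ^ 2 + (C - Y) ^ 2)) := by
  obtain rfl : Y = 2 + u ^ 2 + s ^ 2 - 2 * C - X := by linarith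
  unfold kernelPoly
  linear_combination (-2 * (t ^ 2 - C) ^ 2 + (2 * (t ^ 2 + C)) ^ 2 -
    2 * (t ^ 2 + C) * (2 + u ^ 2 + s ^ 2 - 2 * C) + X * (2 + u ^ 2 + s ^ 2 - 2 * C - X) +
    ((1 - u ^ 2) * (1 - s ^ 2) - 3 * C ^ 2 + C * (2 + u ^ 2 + s ^ 2))) * hmul

/-- A positive superlevel set of `kernelPoly s u t / t ^ 2` in `t > 0` is either empty or bounded by
the four points `c ± p`, `c ± q`. -/
lemma kernelPoly_level {s u l : ℝ} (hs : 0 < s) (hsu : s < u) (hu : u < 1) (hl : 0 < l) :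
    (∃ c p q : ℝ, 0 ≤ q ∧ q ≤ p ∧ p < c ∧ c ^ 2 + p ^ 2 + c ^ 2 + q ^ 2 = 2 + u ^ 2 + s ^ 2 ∧
      (c ^ 2 - p ^ 2) * (c ^ 2 - q ^ 2) = (1 - u ^ 2) * (1 - s ^ 2) ∧
      ∀ t, kernelPoly s u t - l * t ^ 2 =
        -((t ^ 2 - (c - p) ^ 2) * (t ^ 2 - (c + p) ^ 2) *
          ((t ^ 2 - (c - q) ^ 2) * (t ^ 2 - (c + q) ^ 2)))) ∨
    ∀ t, 0 < t → kernelPoly s u t < l * t ^ 2 := by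
  have hu2 : u ^ 2 < 1 := by nlinarith
  have hs2 : s ^ 2 < 1 := by nlinarith
  have hu0 : 0 < u ^ 2 := by nlinarith
  have hs0 : 0 < s ^ 2 := by nlinarith
  obtain ⟨E, hE⟩ : ∃ E, E = 2 + u ^ 2 + s ^ 2 := ⟨_, rfl⟩
  have hk : 0 < (1 - u ^ 2) * (1 - s ^ 2) := mul_pos (by linarith) (by linarith)
  obtain ⟨r, hr0, hr⟩ : ∃ r : ℝ, 0 < r ∧ r ^ 2 = (1 - u ^ 2) * (1 - s ^ 2) :=
    ⟨_, Real.sqrt_pos.2 hk, Real.sq_sqrt hk.le⟩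
  have hr1 : E + 2 * r ≤ 4 := by
    have : 2 * r ≤ (1 - u ^ 2) + (1 - s ^ 2) := by
      refine le_of_sq_le_sq ?_ (by linarith)
      nlinarith [sq_nonneg ((1 - u ^ 2) - (1 - s ^ 2))]
    linarith
  set lev : ℝ → ℝ := fun C ↦
    2 * ((2 * (2 - u ^ 2 - s ^ 2) ^ 2 -
            (1 - u ^ 2) * (1 - s ^ 2) * (6 - u ^ 2 - s ^ 2)) -
          (2 * C * (4 * C - (2 + u ^ 2 + s ^ 2)) ^ 2 -
            (1 - u ^ 2) * (1 - s ^ 2) * (8 * C - (2 + u ^ 2 + s ^ 2)))) with hlev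
  have hcont : Continuous lev := by fun_prop
  by_cases hle : l ≤ lev ((E + 2 * r) / 4)
  · left
    have hmem : l ∈ Set.Icc (lev 1) (lev ((E + 2 * r) / 4)) := by
      refine ⟨?_, hle⟩
      have : lev 1 = 0 := by simp only [hlev]; ring
      linarith
    obtain ⟨C, ⟨hC1, hC2⟩, hC⟩ :=
      intermediate_value_Icc' (by linarith) hcont.continuousOn hmem
    have hE2 : 2 < E := by linarith
    have hD : 0 ≤ (4 * C - E) ^ 2 - 4 * r ^ 2 := by nlinarith
    have hpi : 0 ≤ r ^ 2 - 3 * C ^ 2 + C * E := by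
      rcases le_total (3 * C) E with h | h
      · nlinarith
      · have : r ^ 2 - 3 + E = u ^ 2 * s ^ 2 := by rw [hr, hE]; ring
        nlinarith [mul_nonneg (sub_nonneg.2 hC2) (by linarith : 0 ≤ 3 + 3 * C - E),
          mul_pos hu0 hs0]
    obtain ⟨d, hd0, hd⟩ : ∃ d : ℝ, 0 ≤ d ∧ d ^ 2 = (4 * C - E) ^ 2 - 4 * r ^ 2 :=
      ⟨_, Real.sqrt_nonneg _, Real.sq_sqrt hD⟩
    have hdE : d ≤ E - 2 * C := by
      refine le_of_sq_le_sq ?_ (by linarith)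
      nlinarith
    have hX : (Real.sqrt ((E - 2 * C + d) / 2)) ^ 2 = (E - 2 * C + d) / 2 :=
      Real.sq_sqrt (by linarith)
    have hY : (Real.sqrt ((E - 2 * C - d) / 2)) ^ 2 = (E - 2 * C - d) / 2 :=
      Real.sq_sqrt (by linarith)
    have hCC : (Real.sqrt C) ^ 2 = C := Real.sq_sqrt (by linarith)
    have hprod : (C - (E - 2 * C + d) / 2) * (C - (E - 2 * C - d) / 2) = r ^ 2 := by
      linear_combination (-1 / 4) * hd
    refine ⟨Real.sqrt C, Real.sqrt ((E - 2 * C + d) / 2), Real.sqrt ((E - 2 * C - d) / 2),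
      Real.sqrt_nonneg _, Real.sqrt_le_sqrt (by linarith), Real.sqrt_lt_sqrt (by linarith) ?_,
      ?_, ?_, fun t ↦ ?_⟩
    · have h2 : 0 < C - (E - 2 * C - d) / 2 := by linarith
      have := (pos_iff_pos_of_mul_pos (hprod ▸ (by positivity : 0 < r ^ 2))).2 h2
      linarith
    · rw [hX, hY, hCC, ← hE]; ring
    · rw [hX, hY, hCC, hprod, hr]
    · rw [← hC]
      have := kernelPoly_sub_eq_neg_mul (s := s) (u := u) (C := C) (X := (E - 2 * C + d) / 2)
        (Y := (E - 2 * C - d) / 2) (by rw [← hE]; ring)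
        (by rw [← hE, ← hr]; linear_combination (-1 / 4) * hd) t
      rw [hlev]
      refine this.trans ?_
      rw [← hX, ← hY, ← hCC]
      simp only [Real.sqrt_sq (Real.sqrt_nonneg _)]
      ring
  · right
    intro t ht
    have := kernelPoly_sub_eq_neg_mul (s := s) (u := u) (C := (E + 2 * r) / 4)
        (X := (E - 2 * r) / 4)
        (Y := (E - 2 * r) / 4) (by rw [← hE]; ring)
        (by rw [← hE, ← hr]; ring) t
    have h2 : kernelPoly s u t - lev ((E + 2 * r) / 4) * t ^ 2 ≤ 0 := by
      refine this.trans_le ?_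
      exact neg_nonpos.2 (mul_self_nonneg _)
    nlinarith [mul_pos (sub_pos.2 (not_le.1 hle)) (pow_pos ht 2)]

lemma kernelPoly_pos_left {s u t : ℝ} (hs : 0 < s) (hu : u < 1)
    (ht : t ∈ Set.Ioo (1 - u) (1 - s)) :
    0 < ((1 + u) ^ 2 - t ^ 2) * (t ^ 2 - (1 - u) ^ 2) ∧
    0 < ((1 + t) ^ 2 - s ^ 2) * ((1 - t) ^ 2 - s ^ 2) := by
  obtain ⟨h1, h2⟩ := ht
  constructor <;> apply mul_pos <;> nlinarith

lemma kernelPoly_pos_right {s u t : ℝ} (hs : 0 < s) (hu : u < 1)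
    (ht : t ∈ Set.Ioo (1 + s) (1 + u)) :
    0 < ((1 + u) ^ 2 - t ^ 2) * (t ^ 2 - (1 - u) ^ 2) ∧
    0 < ((1 + t) ^ 2 - s ^ 2) * ((1 - t) ^ 2 - s ^ 2) := by
  obtain ⟨h1, h2⟩ := ht
  constructor <;> apply mul_pos <;> nlinarith

lemma mem_of_kernelPoly_pos {s u t : ℝ} (hs : 0 < s) (hsu : s < u) (hu : u < 1) (ht : 0 < t)
    (h : 0 < kernelPoly s u t) :
    t ∈ Set.Ioo (1 - u) (1 - s) ∨ t ∈ Set.Ioo (1 + s) (1 + u) := by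
  have hfac : kernelPoly s u t = ((1 + u - t) * (t - (1 - u)) * ((1 - s - t) * (1 + s - t))) *
      ((1 + u + t) * (t + (1 - u)) * ((1 + t + s) * (1 + t - s))) := by
    unfold kernelPoly; ring
  rw [hfac] at h
  have h2 : 0 < (1 + u + t) * (t + (1 - u)) * ((1 + t + s) * (1 + t - s)) := by
    have h3 : 0 < 1 + t - s := by linarith
    have h4 : 0 < t + (1 - u) := by linarith
    have h5 : 0 < u := by linarith
    positivity
  have h3 := (pos_iff_pos_of_mul_pos h).2 h2
  by_contra! hcon
  simp only [Set.mem_Ioo, not_and, not_lt] at hcon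
  obtain ⟨hc1, hc2⟩ := hcon
  refine absurd h3 (not_lt.2 ?_)
  rcases le_or_gt t (1 - u) with h | h
  · refine mul_nonpos_of_nonpos_of_nonneg (mul_nonpos_of_nonneg_of_nonpos ?_ ?_) (mul_nonneg ?_ ?_)
      <;> linarith
  · have h6 := hc1 h
    rcases le_or_gt t (1 + s) with h' | h'
    · refine mul_nonpos_of_nonneg_of_nonpos (mul_nonneg ?_ ?_) (mul_nonpos_of_nonpos_of_nonneg ?_ ?_)
        <;> linarith [hc1 h]
    · have h7 := hc2 h'
      refine mul_nonpos_of_nonpos_of_nonneg (mul_nonpos_of_nonpos_of_nonneg ?_ ?_)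
        (mul_nonneg_of_nonpos_of_nonpos ?_ ?_)
        <;> linarith [hc1 h]

open MeasureTheory in
/-- The superlevel sets of the kernel in the two intervals have the same length, so the kernel
pushes Lebesgue measure on the two intervals to the same measure. -/
lemma map_kernel_eq {s u : ℝ} (hs : 0 < s) (hsu : s < u) (hu : u < 1) :
    (volume.restrict (Set.Ioo (1 - u) (1 - s))).map (fun t ↦ kernelPoly s u t / t ^ 2) =
      (volume.restrict (Set.Ioo (1 + s) (1 + u))).map (fun t ↦ kernelPoly s u t / t ^ 2) := by
  have hmeas : Measurable (fun t ↦ kernelPoly s u t / t ^ 2) := by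
    unfold kernelPoly; fun_prop
  refine Measure.ext_of_Ici _ _ fun l ↦ ?_
  rw [Measure.map_apply hmeas measurableSet_Ici, Measure.map_apply hmeas measurableSet_Ici,
    Measure.restrict_apply (hmeas measurableSet_Ici),
    Measure.restrict_apply (hmeas measurableSet_Ici)]
  rcases le_or_gt l 0 with hl | hl
  · rw [Set.inter_eq_right.2, Set.inter_eq_right.2, Real.volume_Ioo, Real.volume_Ioo]
    · congr 1; ring
    · intro t ht
      have := kernelPoly_pos_right hs hu ht
      exact hl.trans (div_nonneg (mul_pos this.1 this.2).le (sq_nonneg t))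
    · intro t ht
      have := kernelPoly_pos_left hs hu ht
      exact hl.trans (div_nonneg (mul_pos this.1 this.2).le (sq_nonneg t))
  have hpre : ∀ t, 0 < t → (l ≤ kernelPoly s u t / t ^ 2 ↔ 0 ≤ kernelPoly s u t - l * t ^ 2) :=
    fun t ht ↦ by rw [le_div_iff₀ (by positivity), sub_nonneg]
  rcases kernelPoly_level hs hsu hu hl with ⟨c, p, q, hq, hqp, hpc, hsum, hprod, hfac⟩ | hempty
  · have hpos : ∀ t, 0 < t → (0 ≤ kernelPoly s u t - l * t ^ 2 ↔
        t ∈ Set.Icc (c - p) (c - q) ∨ t ∈ Set.Icc (c + q) (c + p)) := by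
      intro t ht
      have hfac' : kernelPoly s u t - l * t ^ 2 =
          (((t - (c - p)) * (c + p - t)) * ((t - (c - q)) * (t - (c + q)))) *
          ((t + (c - p)) * (t + (c + p)) * ((t + (c - q)) * (t + (c + q)))) := by
        rw [hfac]; ring
      have h1 : 0 < t + (c - p) := by linarith
      have h2 : 0 < t + (c - q) := by linarith
      have h3 : 0 < t + (c + q) := by linarith
      have h4 : 0 < t + (c + p) := by linarith
      rw [hfac', mul_nonneg_iff_of_pos_right (by positivity)]
      constructor
      · intro h
        by_contra! hcon
        simp only [Set.mem_Icc, not_and, not_le] at hcon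
        obtain ⟨hc1, hc2⟩ := hcon
        refine absurd h (not_le.2 ?_)
        rcases lt_or_ge t (c - p) with h | h
        · refine mul_neg_of_neg_of_pos (mul_neg_of_neg_of_pos ?_ ?_)
            (mul_pos_of_neg_of_neg ?_ ?_) <;> linarith
        · have h6 := hc1 h
          rcases lt_or_ge t (c + q) with h' | h'
          · refine mul_neg_of_pos_of_neg (mul_pos ?_ ?_)
              (mul_neg_of_pos_of_neg ?_ ?_) <;> linarith
          · have h7 := hc2 h'
            refine mul_neg_of_neg_of_pos (mul_neg_of_pos_of_neg ?_ ?_)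
              (mul_pos ?_ ?_) <;> linarith
      · rintro (⟨ha, hb⟩ | ⟨ha, hb⟩)
        · refine mul_nonneg (mul_nonneg ?_ ?_) (mul_nonneg_of_nonpos_of_nonpos ?_ ?_) <;> linarith
        · refine mul_nonneg (mul_nonneg ?_ ?_) (mul_nonneg ?_ ?_) <;> linarith
    have hK : ∀ t, 0 < t → 0 ≤ kernelPoly s u t - l * t ^ 2 → 0 < kernelPoly s u t := by
      intro t ht h
      have : 0 < l * t ^ 2 := by positivity
      linarith
    have hone : ¬ 0 ≤ kernelPoly s u 1 - l * 1 ^ 2 := by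
      intro h
      rcases mem_of_kernelPoly_pos hs hsu hu one_pos (hK 1 one_pos h) with h | h
      · linarith [h.2]
      · linarith [h.1]
    rw [hpos 1 one_pos] at hone
    simp only [Set.mem_Icc, not_or, not_and, not_le] at hone
    have hu2 : u ^ 2 < 1 := by nlinarith
    have hs2 : s ^ 2 < 1 := by nlinarith
    have hu0 : 0 < u ^ 2 := by nlinarith
    have hs0 : 0 < s ^ 2 := by nlinarith
    have hlt : c - p < 1 := by
      by_contra! h
      have h1 : 1 ≤ (c - p) * (c + p) := by nlinarith
      have h2 : 1 ≤ (c - q) * (c + q) := by nlinarith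
      nlinarith
    have hgt : 1 < c + p := by
      by_contra! h
      nlinarith
    have hcq : c - q < 1 := hone.1 hlt.le
    have hcq' : 1 < c + q := by
      by_contra! h
      exact absurd (hone.2 h) (not_lt.2 hgt.le)
    have hleft : (fun t ↦ kernelPoly s u t / t ^ 2) ⁻¹' Set.Ici l ∩ Set.Ioo (1 - u) (1 - s) =
        Set.Icc (c - p) (c - q) := by
      ext t
      simp only [Set.mem_inter_iff, Set.mem_preimage, Set.mem_Ici]
      constructor
      · rintro ⟨h1, h2⟩
        have ht : 0 < t := by linarith [h2.1]
        rw [hpre t ht, hpos t ht] at h1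
        rcases h1 with h1 | h1
        · exact h1
        · linarith [h1.1, h2.2]
      · intro h
        have ht : 0 < t := by linarith [h.1]
        have h1 := (hpos t ht).2 (Or.inl h)
        refine ⟨(hpre t ht).2 h1, ?_⟩
        rcases mem_of_kernelPoly_pos hs hsu hu ht (hK t ht h1) with h2 | h2
        · exact h2
        · linarith [h.2, h2.1]
    have hright : (fun t ↦ kernelPoly s u t / t ^ 2) ⁻¹' Set.Ici l ∩ Set.Ioo (1 + s) (1 + u) =
        Set.Icc (c + q) (c + p) := by
      ext t
      simp only [Set.mem_inter_iff, Set.mem_preimage, Set.mem_Ici]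
      constructor
      · rintro ⟨h1, h2⟩
        have ht : 0 < t := by linarith [h2.1]
        rw [hpre t ht, hpos t ht] at h1
        rcases h1 with h1 | h1
        · linarith [h1.2, h2.1]
        · exact h1
      · intro h
        have ht : 0 < t := by linarith [h.1]
        have h1 := (hpos t ht).2 (Or.inr h)
        refine ⟨(hpre t ht).2 h1, ?_⟩
        rcases mem_of_kernelPoly_pos hs hsu hu ht (hK t ht h1) with h2 | h2
        · linarith [h.1, h2.2]
        · exact h2
    rw [hleft, hright, Real.volume_Icc, Real.volume_Icc]
    congr 1; ring
  · have hemp : ∀ a b : ℝ, 0 ≤ a →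
        (fun t ↦ kernelPoly s u t / t ^ 2) ⁻¹' Set.Ici l ∩ Set.Ioo a b = ∅ := by
      intro a b ha
      ext t
      simp only [Set.mem_inter_iff, Set.mem_preimage, Set.mem_Ici, Set.mem_empty_iff_false,
        iff_false, not_and]
      intro h1 h2
      have ht : 0 < t := ha.trans_lt h2.1
      rw [hpre t ht] at h1
      linarith [hempty t ht]
    rw [hemp _ _ (by linarith), hemp _ _ (by linarith)]

lemma rpow_mul_rpow_mul_rpow_eq {t A B α : ℝ} (ht : 0 < t) (hA : 0 ≤ A) (hB : 0 ≤ B) :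
    t ^ (1 - 2 * α) * A ^ (α - 1 / 2) * B ^ (α - 1 / 2) = (A * B / t ^ 2) ^ (α - 1 / 2) := by
  have h : t ^ (1 - 2 * α) = ((t ^ 2) ^ (α - 1 / 2))⁻¹ := by
    rw [← Real.rpow_natCast t 2, ← Real.rpow_mul ht.le, ← Real.rpow_neg ht.le]
    congr 1
    push_cast
    ring
  rw [Real.div_rpow (mul_nonneg hA hB) (sq_nonneg t), Real.mul_rpow hA hB, h]
  ring

open MeasureTheory in
lemma lintegral_rpow_neg_half_le {a b : ℝ} (hab : a < b) :
    ∫⁻ t in Set.Ioo a b, ENNReal.ofReal (((t - a) * (b - t)) ^ (-(1 / 2) : ℝ)) ≤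
      ENNReal.ofReal (4 * 2 ^ (1 / 2 : ℝ)) := by
  have hL : 0 < (b - a) / 2 := by linarith
  have hint1 : IntervalIntegrable (fun t ↦ (t - a) ^ (-(1 / 2) : ℝ)) volume a b := by
    have := (intervalIntegral.intervalIntegrable_rpow' (r := (-(1 / 2) : ℝ)) (a := 0) (b := b - a)
      (by norm_num)).comp_sub_right a
    simpa using this
  have hint2 : IntervalIntegrable (fun t ↦ (b - t) ^ (-(1 / 2) : ℝ)) volume a b := by
    have := (intervalIntegral.intervalIntegrable_rpow' (r := (-(1 / 2) : ℝ)) (a := b - a) (b := 0)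
      (by norm_num)).comp_sub_left b
    simpa using this
  have hint : IntervalIntegrable (fun t ↦ ((b - a) / 2) ^ (-(1 / 2) : ℝ) *
      ((t - a) ^ (-(1 / 2) : ℝ) + (b - t) ^ (-(1 / 2) : ℝ))) volume a b :=
    (hint1.add hint2).const_mul _
  have hval : ∫ t in Set.Ioo a b, ((b - a) / 2) ^ (-(1 / 2) : ℝ) *
      ((t - a) ^ (-(1 / 2) : ℝ) + (b - t) ^ (-(1 / 2) : ℝ)) = 4 * 2 ^ (1 / 2 : ℝ) := by
    rw [← integral_Ioc_eq_integral_Ioo, ← intervalIntegral.integral_of_le hab.le,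
      intervalIntegral.integral_const_mul, intervalIntegral.integral_add hint1 hint2,
      intervalIntegral.integral_comp_sub_right (fun x ↦ x ^ (-(1 / 2) : ℝ)),
      intervalIntegral.integral_comp_sub_left (fun x ↦ x ^ (-(1 / 2) : ℝ)), sub_self, sub_self,
      integral_rpow (Or.inl (by norm_num))]
    have h2 : b - a = 2 * ((b - a) / 2) := by ring
    rw [h2, mul_div_cancel_left₀ _ (two_ne_zero),
      Real.mul_rpow zero_le_two hL.le, Real.zero_rpow (by norm_num),
      show (-(1 / 2) + 1 : ℝ) = 1 / 2 by norm_num, Real.rpow_neg hL.le]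
    have : ((b - a) / 2) ^ (1 / 2 : ℝ) ≠ 0 := (Real.rpow_pos_of_pos hL _).ne'
    field_simp
    ring
  rw [← hval, ofReal_integral_eq_lintegral_ofReal]
  · refine setLIntegral_mono' measurableSet_Ioo fun t ht ↦ ENNReal.ofReal_le_ofReal ?_
    have h1 : 0 < t - a := sub_pos.2 ht.1
    have h2 : 0 < b - t := sub_pos.2 ht.2
    have h3 := Real.rpow_pos_of_pos h1 (-(1 / 2))
    have h4 := Real.rpow_pos_of_pos h2 (-(1 / 2))
    have h5 := Real.rpow_pos_of_pos hL (-(1 / 2))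
    rw [Real.mul_rpow h1.le h2.le, mul_add]
    rcases le_total ((b - a) / 2) (t - a) with h | h
    · have := Real.rpow_le_rpow_of_nonpos hL h (by norm_num : (-(1 / 2) : ℝ) ≤ 0)
      nlinarith [mul_pos h5 h3]
    · have := Real.rpow_le_rpow_of_nonpos hL (by linarith : (b - a) / 2 ≤ b - t)
        (by norm_num : (-(1 / 2) : ℝ) ≤ 0)
      nlinarith [mul_pos h5 h4]
  · exact (intervalIntegrable_iff_integrableOn_Ioo_of_le hab.le).1 hint
  · refine (ae_restrict_iff' measurableSet_Ioo).2 (.of_forall fun t ht ↦ ?_)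
    have h1 : 0 < t - a := sub_pos.2 ht.1
    have h2 : 0 < b - t := sub_pos.2 ht.2
    simp only [Pi.zero_apply]
    positivity

open MeasureTheory in
lemma lintegral_kernel_left_le {α s u : ℝ} (hα : 0 ≤ α) (hs : 0 < s) (hsu : s < u) (hu : u < 1) :
    ∫⁻ t in Set.Ioo (1 - u) (1 - s), ‖(kernelPoly s u t / t ^ 2) ^ (α - 1 / 2)‖ₑ ≤
      ENNReal.ofReal (16 ^ α * (4 * s ^ 2) ^ (-(1 / 2) : ℝ)) *
        ENNReal.ofReal (4 * 2 ^ (1 / 2 : ℝ)) := by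
  refine le_trans ?_ (mul_le_mul_right (lintegral_rpow_neg_half_le
    (by linarith : 1 - u < 1 - s)) _)
  rw [← lintegral_const_mul' _ _ ENNReal.ofReal_ne_top]
  refine setLIntegral_mono' measurableSet_Ioo fun t ht ↦ ?_
  have hpos := kernelPoly_pos_left hs hu ht
  obtain ⟨h1, h2⟩ := ht
  have ht : 0 < t := by linarith
  have hK : 0 < kernelPoly s u t / t ^ 2 := div_pos (mul_pos hpos.1 hpos.2) (by positivity)
  rw [← ENNReal.ofReal_mul (by positivity),
    Real.enorm_of_nonneg (Real.rpow_nonneg hK.le _)]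
  refine ENNReal.ofReal_le_ofReal ?_
  have hupper : kernelPoly s u t / t ^ 2 ≤ 16 := by
    rw [div_le_iff₀ (by positivity)]
    have hA : ((1 + u) ^ 2 - t ^ 2) * (t ^ 2 - (1 - u) ^ 2) ≤ 4 * t ^ 2 := by
      refine mul_le_mul ?_ ?_ ?_ ?_ <;> nlinarith
    have hB : ((1 + t) ^ 2 - s ^ 2) * ((1 - t) ^ 2 - s ^ 2) ≤ 4 * 1 := by
      refine mul_le_mul ?_ ?_ ?_ ?_ <;> nlinarith
    have := mul_le_mul hA hB hpos.2.le (by positivity)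
    unfold kernelPoly
    linarith
  have hlower : 4 * s ^ 2 * ((t - (1 - u)) * (1 - s - t)) ≤ kernelPoly s u t / t ^ 2 := by
    rw [le_div_iff₀ (by positivity)]
    have hxy : 0 < (t - (1 - u)) * (1 - s - t) := mul_pos (by linarith) (by linarith)
    have e1 : 2 * s * (2 * s) ≤ (1 + u - t) * (1 + s - t) :=
      mul_le_mul (by linarith) (by linarith) (by linarith) (by linarith)
    have e2 : 1 * 1 ≤ (1 + u + t) * (1 + t + s) :=
      mul_le_mul (by linarith) (by linarith) (by linarith) (by linarith)
    have e3 : t * t ≤ (t + (1 - u)) * (1 + t - s) :=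
      mul_le_mul (by linarith) (by linarith) (by linarith) (by linarith)
    have e4 := mul_le_mul (mul_le_mul e1 e2 (by norm_num) (by nlinarith)) e3 (by positivity)
      (by nlinarith)
    have e5 := mul_le_mul_of_nonneg_right e4 hxy.le
    unfold kernelPoly
    linarith
  have hxy : 0 < (t - (1 - u)) * (1 - s - t) := mul_pos (by linarith) (by linarith)
  rw [sub_eq_add_neg, Real.rpow_add hK, mul_assoc, ← Real.mul_rpow (by positivity) hxy.le]
  exact mul_le_mul (Real.rpow_le_rpow hK.le hupper hα)
    (Real.rpow_le_rpow_of_nonpos (by positivity) hlower (by norm_num))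
    (Real.rpow_nonneg hK.le _) (by positivity)

open MeasureTheory in
lemma lintegral_kernel_right_eq {α s u : ℝ} (hs : 0 < s) (hsu : s < u) (hu : u < 1) :
    ∫⁻ t in Set.Ioo (1 + s) (1 + u), ‖(kernelPoly s u t / t ^ 2) ^ (α - 1 / 2)‖ₑ =
      ∫⁻ t in Set.Ioo (1 - u) (1 - s), ‖(kernelPoly s u t / t ^ 2) ^ (α - 1 / 2)‖ₑ := by
  have hmeas : Measurable (fun t ↦ kernelPoly s u t / t ^ 2) := by
    unfold kernelPoly; fun_prop
  have hpow : Measurable (fun x : ℝ ↦ ‖x ^ (α - 1 / 2)‖ₑ) := by fun_prop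
  rw [← lintegral_map hpow hmeas, ← map_kernel_eq hs hsu hu, lintegral_map hpow hmeas]

open MeasureTheory in
lemma integral_kernel_right_eq {α s u : ℝ} (hs : 0 < s) (hsu : s < u) (hu : u < 1) :
    ∫ t in Set.Ioo (1 + s) (1 + u), (kernelPoly s u t / t ^ 2) ^ (α - 1 / 2) =
      ∫ t in Set.Ioo (1 - u) (1 - s), (kernelPoly s u t / t ^ 2) ^ (α - 1 / 2) := by
  have hmeas : Measurable (fun t ↦ kernelPoly s u t / t ^ 2) := by
    unfold kernelPoly; fun_prop
  have hpow : Measurable (fun x : ℝ ↦ x ^ (α - 1 / 2)) := by fun_prop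
  rw [← integral_map hmeas.aemeasurable hpow.aestronglyMeasurable, ← map_kernel_eq hs hsu hu,
    integral_map hmeas.aemeasurable hpow.aestronglyMeasurable]

open MeasureTheory in
lemma integral_integral_kernel_swap {α s M : ℝ} {C : ENNReal} (hC : C ≠ ⊤) {G a b : ℝ → ℝ}
    (hG : Measurable G) (hGM : ∀ u, |G u| ≤ M) (hG0 : ∀ u ∉ Set.Ioo s 1, G u = 0)
    (ha : Continuous a) (hb : Continuous b)
    (hbound : ∀ u ∈ Set.Ioo s 1,
      ∫⁻ t in Set.Ioo (a u) (b u), ‖(kernelPoly s u t / t ^ 2) ^ (α - 1 / 2)‖ₑ ≤ C) :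
    ∫ t, ∫ u, G u *
        (Set.Ioo (a u) (b u)).indicator (fun t ↦ (kernelPoly s u t / t ^ 2) ^ (α - 1 / 2)) t =
      ∫ u, G u * ∫ t in Set.Ioo (a u) (b u), (kernelPoly s u t / t ^ 2) ^ (α - 1 / 2) := by
  have hset : MeasurableSet {x : ℝ × ℝ | x.1 ∈ Set.Ioo (a x.2) (b x.2)} :=
    (measurableSet_lt (f := fun x : ℝ × ℝ ↦ a x.2) (by fun_prop) measurable_fst).inter
      (measurableSet_lt (g := fun x : ℝ × ℝ ↦ b x.2) measurable_fst (by fun_prop))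
  have hmeas : Measurable (Function.uncurry fun t u ↦ G u *
      (Set.Ioo (a u) (b u)).indicator
        (fun t ↦ (kernelPoly s u t / t ^ 2) ^ (α - 1 / 2)) t) := by
    have hK : Measurable fun x : ℝ × ℝ ↦ (kernelPoly s x.2 x.1 / x.1 ^ 2) ^ (α - 1 / 2) := by
      unfold kernelPoly; fun_prop
    exact (hG.comp measurable_snd).mul (hK.indicator hset)
  rw [integral_integral_swap]
  · refine integral_congr_ae (.of_forall fun u ↦ ?_)
    simp only
    rw [integral_const_mul, integral_indicator measurableSet_Ioo]
  refine ⟨hmeas.aestronglyMeasurable, ?_⟩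
  rw [hasFiniteIntegral_iff_enorm, lintegral_prod_symm' _ hmeas.enorm]
  have hle : ∀ u, ∫⁻ t, ‖Function.uncurry (fun t u ↦ G u * (Set.Ioo (a u) (b u)).indicator
      (fun t ↦ (kernelPoly s u t / t ^ 2) ^ (α - 1 / 2)) t) (t, u)‖ₑ ≤
      (Set.Ioo s 1).indicator (fun _ ↦ ENNReal.ofReal M * C) u := by
    intro u
    simp only [Function.uncurry_apply_pair, enorm_mul]
    by_cases hu : u ∈ Set.Ioo s 1
    · rw [Set.indicator_of_mem hu, lintegral_const_mul' _ _ (by simp)]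
      simp only [enorm_indicator_eq_indicator_enorm]
      rw [lintegral_indicator measurableSet_Ioo]
      refine mul_le_mul' ?_ (hbound u hu)
      rw [Real.enorm_eq_ofReal_abs]
      exact ENNReal.ofReal_le_ofReal (hGM u)
    · simp [hG0 u hu]
  refine (lintegral_mono hle).trans_lt ?_
  rw [lintegral_indicator measurableSet_Ioo, setLIntegral_const]
  exact ENNReal.mul_lt_top (ENNReal.mul_lt_top (by simp) hC.lt_top) (by simp)

open MeasureTheory in
lemma integral_transform_eq {α s c d : ℝ} {f h a b : ℝ → ℝ} (hcd : c ≤ d)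
    (hh : ∀ t : ℝ, h t =
      ∫ u in |1 - t|..1,
        u * f u * ((((1 + u) ^ 2 - t ^ 2) * (t ^ 2 - (1 - u) ^ 2)) ^ (α - 1 / 2)))
    (hc : 0 ≤ c) (hd : d ≤ 2)
    (hiff : ∀ t u, (u ∈ Set.Ioo s 1 ∧ t ∈ Set.Ioo (a u) (b u)) ↔
      (t ∈ Set.Ioo c d ∧ u ∈ Set.Ioo |1 - t| 1))
    (hpos : ∀ t u, u ∈ Set.Ioo s 1 → t ∈ Set.Ioo (a u) (b u) →
      0 < ((1 + u) ^ 2 - t ^ 2) * (t ^ 2 - (1 - u) ^ 2) ∧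
      0 < ((1 + t) ^ 2 - s ^ 2) * ((1 - t) ^ 2 - s ^ 2)) :
    ∫ t in c..d, t ^ (1 - 2 * α) * h t *
        ((((1 + t) ^ 2 - s ^ 2) * ((1 - t) ^ 2 - s ^ 2)) ^ (α - 1 / 2)) =
      ∫ t, ∫ u, (Set.Ioo s 1).indicator (fun u ↦ u * f u) u *
        (Set.Ioo (a u) (b u)).indicator
          (fun t ↦ (kernelPoly s u t / t ^ 2) ^ (α - 1 / 2)) t := by
  have hzero : ∀ t u, ¬ (t ∈ Set.Ioo c d ∧ u ∈ Set.Ioo |1 - t| 1) →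
      (Set.Ioo s 1).indicator (fun u ↦ u * f u) u * (Set.Ioo (a u) (b u)).indicator
        (fun t ↦ (kernelPoly s u t / t ^ 2) ^ (α - 1 / 2)) t = 0 := by
    intro t u h
    rw [← hiff, not_and_or] at h
    rcases h with h | h
    · rw [Set.indicator_of_notMem h, zero_mul]
    · rw [Set.indicator_of_notMem h, mul_zero]
  have houter : ∀ t ∉ Set.Ioo c d, ∫ u, (Set.Ioo s 1).indicator (fun u ↦ u * f u) u *
      (Set.Ioo (a u) (b u)).indicator
        (fun t ↦ (kernelPoly s u t / t ^ 2) ^ (α - 1 / 2)) t = 0 := fun t ht ↦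
    integral_eq_zero_of_ae (.of_forall fun u ↦ hzero t u fun h ↦ ht h.1)
  rw [intervalIntegral.integral_of_le hcd, integral_Ioc_eq_integral_Ioo,
    ← setIntegral_eq_integral_of_forall_compl_eq_zero houter]
  refine setIntegral_congr_fun measurableSet_Ioo fun t ht ↦ ?_
  have ht0 : 0 < t := hc.trans_lt ht.1
  have habs : |1 - t| ≤ 1 := by
    rw [abs_le]; constructor <;> linarith [ht.2]
  rw [← setIntegral_eq_integral_of_forall_compl_eq_zero (s := Set.Ioo |1 - t| 1)
    (fun u hu ↦ hzero t u fun h ↦ hu h.2), hh, intervalIntegral.integral_of_le habs,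
    integral_Ioc_eq_integral_Ioo, ← integral_const_mul, ← integral_mul_const]
  refine setIntegral_congr_fun measurableSet_Ioo fun u hu ↦ ?_
  obtain ⟨h1, h2⟩ := (hiff t u).2 ⟨ht, hu⟩
  obtain ⟨hA, hB⟩ := hpos t u h1 h2
  rw [Set.indicator_of_mem h1, Set.indicator_of_mem h2, kernelPoly,
    ← rpow_mul_rpow_mul_rpow_eq ht0 hA.le hB.le]
  ring

/-- **Necessity of the range condition, radial case** (Theorem `range`, necessity),
stated for a general real exponent `α ≥ 0`.  Let `f` be a smooth function on `[0,1)`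
with compact support contained in `[0,1)`, and for `t ∈ (0,2)` let
`h(t) = ∫_{|1-t|}^1 u f(u) ([(1+u)²-t²][t²-(1-u)²])^{α-1/2} du`.
Then for every `s ∈ (0,1)`,
`∫_0^{1-s} t^{1-2α} h(t) ([(1+t)²-s²][(1-t)²-s²])^{α-1/2} dt
  = ∫_{1+s}^2 t^{1-2α} h(t) ([(1+t)²-s²][(1-t)²-s²])^{α-1/2} dt`. -/
theorem radial_range_condition_necessity
    (α : ℝ) (hα : 0 ≤ α)
    (f : ℝ → ℝ) (hf : ContDiffOn ℝ (⊤ : ℕ∞) f (Set.Ico 0 1))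
    (hsupp : ∃ ρ : ℝ, ρ < 1 ∧ ∀ u : ℝ, ρ ≤ u → f u = 0)
    (h : ℝ → ℝ)
    (hh : ∀ t : ℝ, h t =
      ∫ u in |1 - t|..1,
        u * f u * ((((1 + u) ^ 2 - t ^ 2) * (t ^ 2 - (1 - u) ^ 2)) ^ (α - 1 / 2))) :
    ∀ s ∈ Set.Ioo (0 : ℝ) 1,
      (∫ t in (0 : ℝ)..(1 - s),
          t ^ (1 - 2 * α) * h t *
            ((((1 + t) ^ 2 - s ^ 2) * ((1 - t) ^ 2 - s ^ 2)) ^ (α - 1 / 2)))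
        = ∫ t in (1 + s)..(2 : ℝ),
            t ^ (1 - 2 * α) * h t *
              ((((1 + t) ^ 2 - s ^ 2) * ((1 - t) ^ 2 - s ^ 2)) ^ (α - 1 / 2)) := by
  rintro s ⟨hs, hs1⟩
  obtain ⟨ρ, hρ, hfρ⟩ := hsupp
  obtain ⟨M, hM⟩ : ∃ M, ∀ u ∈ Set.Icc 0 ρ, ‖f u‖ ≤ M :=
    isCompact_Icc.exists_bound_of_continuousOn
      (hf.continuousOn.mono fun u hu ↦ ⟨hu.1, hu.2.trans_lt hρ⟩)
  have hG : Measurable ((Set.Ioo s 1).indicator fun u ↦ u * f u) := by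
    classical
    rw [← Set.piecewise_eq_indicator]
    refine ContinuousOn.measurable_piecewise ?_ continuousOn_const measurableSet_Ioo
    exact continuousOn_id.mul (hf.continuousOn.mono fun u hu ↦ ⟨(hs.trans hu.1).le, hu.2⟩)
  have hGM : ∀ u, |(Set.Ioo s 1).indicator (fun u ↦ u * f u) u| ≤ |M| := by
    intro u
    by_cases hu : u ∈ Set.Ioo s 1
    · rw [Set.indicator_of_mem hu]
      rcases le_total u ρ with h' | h'
      · have h1 := hM u ⟨(hs.trans hu.1).le, h'⟩
        rw [Real.norm_eq_abs] at h1
        rw [abs_mul, abs_of_pos (hs.trans hu.1)]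
        exact (mul_le_of_le_one_left (abs_nonneg _) hu.2.le).trans (h1.trans (le_abs_self M))
      · simp [hfρ u h']
    · simp [Set.indicator_of_notMem hu]
  have hG0 : ∀ u ∉ Set.Ioo s 1, (Set.Ioo s 1).indicator (fun u ↦ u * f u) u = 0 :=
    fun u hu ↦ Set.indicator_of_notMem hu _
  have hC := ENNReal.mul_ne_top
    (ENNReal.ofReal_ne_top (r := 16 ^ α * (4 * s ^ 2) ^ (-(1 / 2) : ℝ)))
    (ENNReal.ofReal_ne_top (r := 4 * 2 ^ (1 / 2 : ℝ)))
  rw [integral_transform_eq (a := fun u ↦ 1 - u) (b := fun _ ↦ 1 - s) (by linarith) hh le_rfl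
      (by linarith) ?_ (fun t u hu ht ↦ kernelPoly_pos_left hs hu.2 ht),
    integral_transform_eq (a := fun _ ↦ 1 + s) (b := fun u ↦ 1 + u) (by linarith) hh
      (by linarith) le_rfl ?_ (fun t u hu ht ↦ kernelPoly_pos_right hs hu.2 ht),
    integral_integral_kernel_swap hC hG hGM hG0 (by fun_prop) (by fun_prop)
      (fun u hu ↦ lintegral_kernel_left_le hα hs hu.1 hu.2),
    integral_integral_kernel_swap hC hG hGM hG0 (by fun_prop) (by fun_prop)
      (fun u hu ↦ (lintegral_kernel_right_eq hs hu.1 hu.2).trans_le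
        (lintegral_kernel_left_le hα hs hu.1 hu.2))]
  · refine MeasureTheory.integral_congr_ae (.of_forall fun u ↦ ?_)
    by_cases hu : u ∈ Set.Ioo s 1
    · simp only [integral_kernel_right_eq hs hu.1 hu.2]
    · simp only [hG0 u hu, zero_mul]
  · intro t u
    simp only [Set.mem_Ioo, abs_lt]
    constructor
    · rintro ⟨⟨h1, h2⟩, h3, h4⟩
      refine ⟨⟨?_, ?_⟩, ⟨?_, ?_⟩, ?_⟩ <;> linarith
    · rintro ⟨⟨h1, h2⟩, ⟨h3, h4⟩, h5⟩
      refine ⟨⟨?_, ?_⟩, ?_, ?_⟩ <;> linarith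
  · intro t u
    simp only [Set.mem_Ioo, abs_lt]
    constructor
    · rintro ⟨⟨h1, h2⟩, h3, h4⟩
      refine ⟨⟨?_, ?_⟩, ⟨?_, ?_⟩, ?_⟩ <;> linarith
    · rintro ⟨⟨h1, h2⟩, ⟨h3, h4⟩, h5⟩
      refine ⟨⟨?_, ?_⟩, ?_, ?_⟩ <;> linarith
end
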